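/- Let D ⊆ (0,1) and f : D → (0,1). Suppose there exist disjoint regular languages L₀, L₁ over the alphabet {0,1} such that L₀ ∪ L₁ has the prefix property and, for every p ∈ D, P_p(L₀ ∪ L₁) = 1 and P_p(L₁) = f(p). Then f can be block simulated: there exist k ≥ 1 and disjoint sets A₀, A₁ ⊆ {0,1}^k with A₀ ∪ A₁ nonempty, such that for every p ∈ D, P_p(A₀ ∪ A₁) > 0 and f(p) = P_p(A₁) / P_p(A₀ ∪ A₁). -/

import Mathlib

/-- Probability of a word `w` under i.i.d. `p`-coin tosses. -/
noncomputable def wordProb (p : ℝ) (w : List Bool) : ℝ :=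
  p ^ (w.count true) * (1 - p) ^ (w.count false)

/-- Probability of a language under i.i.d. `p`-coin tosses. -/
noncomputable def langProb (p : ℝ) (L : Set (List Bool)) : ℝ :=
  ∑' w : L, wordProb p (w : List Bool)

/-- Probability of a finite set of words under i.i.d. `p`-coin tosses. -/
noncomputable def finsetProb (p : ℝ) (A : Finset (List Bool)) : ℝ :=
  ∑ w ∈ A, wordProb p w

/-- A language has the prefix property if no word of it is a proper prefix
of another word of it. -/
def PrefixFree (L : Set (List Bool)) : Prop :=
  ∀ u ∈ L, ∀ v ∈ L, u ≠ v → ¬ u <+: v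

theorem tsum_union_disjoint_of_ne_zero {α : Type*} {g : α → ℝ} {s t : Set α} (hd : Disjoint s t)
    (h : ∑' x : ↥(s ∪ t), g x ≠ 0) :
    ∑' x : ↥(s ∪ t), g x = ∑' x : s, g x + ∑' x : t, g x := by
  have hs : Summable fun x : ↥(s ∪ t) => g x := by
    by_contra hs
    exact h (tsum_eq_zero_of_not_summable hs)
  have hs₀ : Summable (g ∘ ((↑) : s → α)) :=
    hs.comp_injective (Set.inclusion_injective Set.subset_union_left)
  have hs₁ : Summable (g ∘ ((↑) : t → α)) :=
    hs.comp_injective (Set.inclusion_injective Set.subset_union_right)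
  exact hs₀.tsum_union_disjoint hd hs₁

section

open scoped Classical

/-- Probability of the letter `b` under a `p`-coin toss. -/
noncomputable def letterProb (p : ℝ) (b : Bool) : ℝ := if b then p else 1 - p

theorem letterProb_pos {p : ℝ} (hp : p ∈ Set.Ioo (0 : ℝ) 1) (b : Bool) : 0 < letterProb p b := by
  cases b
  · simpa [letterProb] using hp.2
  · simpa [letterProb] using hp.1

theorem wordProb_nil (p : ℝ) : wordProb p [] = 1 := by simp [wordProb]

theorem wordProb_cons (p : ℝ) (b : Bool) (w : List Bool) :
    wordProb p (b :: w) = letterProb p b * wordProb p w := by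
  cases b <;> simp [wordProb, letterProb, pow_succ] <;> ring

theorem wordProb_eq_prod (p : ℝ) (w : List Bool) :
    wordProb p w = (w.map (letterProb p)).prod := by
  induction w with
  | nil => exact wordProb_nil p
  | cons b w ih => rw [wordProb_cons, ih, List.map_cons, List.prod_cons]

theorem wordProb_pos {p : ℝ} (hp : p ∈ Set.Ioo (0 : ℝ) 1) (w : List Bool) : 0 < wordProb p w := by
  have := hp.1
  have := sub_pos.2 hp.2
  unfold wordProb
  positivity

variable {σ : Type*}

/-- `Leads δ X c T u`: starting from `u` and following in every state the arrow chosen by `c`,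
one reaches a state of `T` before leaving any state of `X`. -/
inductive Leads (δ : σ → Bool → σ) (X : Set σ) (c : σ → Bool) (T : Set σ) : σ → Prop
  | here {u : σ} : u ∈ T → Leads δ X c T u
  | step {u : σ} : u ∉ X → Leads δ X c T (δ u (c u)) → Leads δ X c T u

/-- The arrows chosen by `c` form a forest with all roots in `X`. -/
def IsForest (δ : σ → Bool → σ) (X : Set σ) (c : σ → Bool) : Prop := ∀ u, Leads δ X c X u

section Leads

variable {δ : σ → Bool → σ} {X T : Set σ} {c : σ → Bool} {s u : σ} {b : Bool}

theorem Leads.mem (h : Leads δ X c T u) (hu : u ∈ X) : u ∈ T := by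
  cases h with
  | here h => exact h
  | step h _ => exact absurd hu h

theorem leads_iff_step (hTX : T ⊆ X) (hu : u ∉ X) :
    Leads δ X c T u ↔ Leads δ X c T (δ u (c u)) := by
  refine ⟨fun h => ?_, Leads.step hu⟩
  cases h with
  | here h => exact absurd (hTX h) hu
  | step _ h => exact h

theorem Leads.disjoint {T' : Set σ} (hTX : T ⊆ X) (hTX' : T' ⊆ X) (hd : Disjoint T T')
    (h : Leads δ X c T u) : ¬ Leads δ X c T' u := by
  induction h with
  | here h => exact fun h' => Set.disjoint_left.1 hd h (h'.mem (hTX h))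
  | step hu _ ih => rwa [leads_iff_step hTX' hu]

theorem Leads.hits_or_update (h : Leads δ X c T u) :
    Leads δ X c {s} u ∨ Leads δ X (Function.update c s b) T u := by
  induction h with
  | here h => exact .inr (.here h)
  | @step u hu _ ih =>
    by_cases hus : u = s
    · exact .inl (.here hus)
    · refine ih.imp (.step hu) fun h => .step hu ?_
      rwa [Function.update_of_ne hus]

theorem Leads.iff_of_hits (hTX : T ⊆ X) (h : Leads δ X c {s} u) :
    Leads δ X c T u ↔ Leads δ X c T s := by
  induction h with
  | here h => rw [Set.mem_singleton_iff.1 h]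
  | step hu _ ih => rw [leads_iff_step hTX hu, ih]

theorem Leads.hits_update (h : Leads δ X c {s} u) :
    Leads δ X (Function.update c s b) {s} u := by
  rcases h.hits_or_update (s := s) (b := b) with h' | h'
  · clear h'
    induction h with
    | here h => exact .here h
    | @step u hu _ ih =>
      by_cases hus : u = s
      · exact .here hus
      · refine .step hu ?_
        rwa [Function.update_of_ne hus]
  · exact h'

theorem Leads.not_cycle (hs : s ∉ X) (hcyc : Leads δ X c {s} (δ s (c s)))
    (h : Leads δ X c X u) : ¬ Leads δ X c {s} u := by
  induction h with
  | here h => exact fun h' => hs (Set.mem_singleton_iff.1 (h'.mem h) ▸ h)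
  | @step u hu _ ih =>
    intro h'
    cases h' with
    | here h' => exact ih (Set.mem_singleton_iff.1 h' ▸ hcyc)
    | step _ h' => exact ih h'

theorem leads_iff_of_isForest_update (hTX : T ⊆ X) (hs : s ∉ X)
    (hc' : IsForest δ X (Function.update c s b)) :
    Leads δ X c T (δ s b) ↔ Leads δ X (Function.update c s b) T s := by
  have hno : ¬ Leads δ X (Function.update c s b) {s} (δ s b) := by
    intro h
    refine Leads.not_cycle hs ?_ (hc' _) h
    rwa [Function.update_self]
  rw [leads_iff_step hTX hs, Function.update_self]
  constructor
  · intro h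
    exact (h.hits_or_update (s := s) (b := b)).resolve_left fun h => hno h.hits_update
  · intro h
    simpa using (h.hits_or_update (s := s) (b := c s)).resolve_left hno

theorem leads_iff_of_not_isForest_update (hTX : T ⊆ X) (hs : s ∉ X) (hc : IsForest δ X c)
    (hc' : ¬ IsForest δ X (Function.update c s b)) :
    Leads δ X c T (δ s b) ↔ Leads δ X c T s := by
  refine Leads.iff_of_hits hTX ?_
  by_contra hno
  have h1 := ((hc (δ s b)).hits_or_update (s := s) (b := b)).resolve_left hno
  have h2 : Leads δ X (Function.update c s b) X s := .step hs (by rwa [Function.update_self])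
  exact hc' fun u => ((hc u).hits_or_update (s := s) (b := b)).elim
    (fun h => (h.hits_update.iff_of_hits subset_rfl).2 h2) id

end Leads

/-- The states in `T`, together with those from which `T` cannot be reached. -/
def absorbing (δ : σ → Bool → σ) (T : Set σ) : Set σ :=
  {u | u ∈ T ∨ ∀ w : List Bool, w.foldl δ u ∉ T}

theorem exists_isForest (δ : σ → Bool → σ) (T : Set σ) :
    ∃ c, IsForest δ (absorbing δ T) c := by
  have key : ∀ u, ∃ b, ∀ n, (∃ w : List Bool, w.length = n + 1 ∧ w.foldl δ u ∈ T) →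
      (∀ w : List Bool, w.length < n + 1 → w.foldl δ u ∉ T) →
      ∃ w : List Bool, w.length = n ∧ w.foldl δ (δ u b) ∈ T := by
    intro u
    by_cases hu : ∃ n, ∃ w : List Bool, w.length = n ∧ w.foldl δ u ∈ T
    · obtain ⟨w, hw, hwT⟩ := Nat.find_spec hu
      cases w with
      | nil =>
        refine ⟨true, fun n _ h => absurd hwT (h [] (by simp))⟩
      | cons b w =>
        refine ⟨b, fun n ⟨v, hv, hvT⟩ h => ⟨w, ?_, hwT⟩⟩
        have h1 := Nat.find_min' hu ⟨v, hv, hvT⟩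
        have h2 : ¬ (b :: w).length < n + 1 := fun h' => h _ h' hwT
        simp only [List.length_cons] at hw h2
        omega
    · exact ⟨true, fun n ⟨v, hv, hvT⟩ _ => absurd ⟨_, v, hv, hvT⟩ hu⟩
  choose c hc using key
  refine ⟨c, ?_⟩
  have main : ∀ n u, (∃ w : List Bool, w.length = n ∧ w.foldl δ u ∈ T) →
      Leads δ (absorbing δ T) c (absorbing δ T) u := by
    intro n
    induction n using Nat.strong_induction_on with
    | _ n ih =>
      intro u hu
      by_cases hlt : ∃ w : List Bool, w.length < n ∧ w.foldl δ u ∈ T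
      · obtain ⟨w, hw, hwT⟩ := hlt
        exact ih _ hw u ⟨w, rfl, hwT⟩
      · push Not at hlt
        by_cases hX : u ∈ absorbing δ T
        · exact .here hX
        cases n with
        | zero =>
          obtain ⟨w, hw, hwT⟩ := hu
          rw [List.length_eq_zero_iff] at hw
          subst hw
          exact .here (.inl hwT)
        | succ n => exact .step hX (ih n n.lt_succ_self _ (hc u n hu hlt))
  intro u
  by_cases hu : ∃ w : List Bool, w.foldl δ u ∈ T
  · obtain ⟨w, hw⟩ := hu
    exact main _ u ⟨w, rfl, hw⟩
  · push Not at hu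
    exact .here (.inr hu)

variable [Fintype σ]

/-- Probability of a choice of arrows, when they are picked by independent `p`-coin tosses. -/
noncomputable def configProb (p : ℝ) (c : σ → Bool) : ℝ := ∏ u, letterProb p (c u)

theorem configProb_pos {p : ℝ} (hp : p ∈ Set.Ioo (0 : ℝ) 1) (c : σ → Bool) :
    0 < configProb p c := Finset.prod_pos fun _ _ => letterProb_pos hp _

theorem configProb_update_mul (p : ℝ) (c : σ → Bool) (s : σ) (b : Bool) :
    configProb p (Function.update c s b) * letterProb p (c s) =
      configProb p c * letterProb p b := by
  unfold configProb
  rw [← Finset.mul_prod_erase _ _ (Finset.mem_univ s),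
    ← Finset.mul_prod_erase _ (fun u => letterProb p (c u)) (Finset.mem_univ s),
    Function.update_self, Finset.prod_congr rfl fun u hu => by
      rw [Function.update_of_ne (Finset.ne_of_mem_erase hu)]]
  ring

/-- The forests in which `u` leads to `T`. -/
noncomputable def forestsTo (δ : σ → Bool → σ) (X T : Set σ) (u : σ) : Finset (σ → Bool) :=
  {c | IsForest δ X c ∧ Leads δ X c T u}

/-- The probability that the chosen arrows form a forest in which `u` leads to `T`. -/
noncomputable def forestProb (p : ℝ) (δ : σ → Bool → σ) (X T : Set σ) (u : σ) : ℝ :=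
  ∑ c ∈ forestsTo δ X T u, configProb p c

theorem forestProb_harmonic (p : ℝ) {δ : σ → Bool → σ} {X T : Set σ} (hTX : T ⊆ X) {s : σ}
    (hs : s ∉ X) :
    forestProb p δ X T s = ∑ b, letterProb p b * forestProb p δ X T (δ s b) := by
  have hsum : ∑ b, letterProb p b = 1 := by simp [letterProb]
  let g : (σ → Bool) × Bool → ℝ := fun x => configProb p x.1 * letterProb p x.2
  let sw : (σ → Bool) × Bool → (σ → Bool) × Bool := fun x => (Function.update x.1 s x.2, x.1 s)
  have hsw : Function.Involutive sw := fun x => by simp [sw]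
  have hg : ∀ x, g (sw x) = g x := fun x => configProb_update_mul p x.1 s x.2
  have hL : forestProb p δ X T s =
      ∑ x, if IsForest δ X x.1 ∧ Leads δ X x.1 T s then g x else 0 := by
    rw [Fintype.sum_prod_type, forestProb, forestsTo, Finset.sum_filter]
    refine Finset.sum_congr rfl fun c _ => ?_
    split_ifs
    · simp only [g]
      rw [← Finset.mul_sum, hsum, mul_one]
    · simp
  have hR : ∑ b, letterProb p b * forestProb p δ X T (δ s b) =
      ∑ x, if IsForest δ X x.1 ∧ Leads δ X x.1 T (δ s x.2) then g x else 0 := by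
    rw [Fintype.sum_prod_type_right]
    refine Finset.sum_congr rfl fun b _ => ?_
    rw [forestProb, forestsTo, Finset.sum_filter, Finset.mul_sum]
    refine Finset.sum_congr rfl fun c _ => ?_
    simp only [g]
    split_ifs
    · ring
    · ring
  let k : (σ → Bool) × Bool → ℝ := fun x =>
    if IsForest δ X x.1 ∧ IsForest δ X (sw x).1 ∧ Leads δ X x.1 T s then g x else 0
  have hR' : ∀ x : (σ → Bool) × Bool,
      (if IsForest δ X x.1 ∧ Leads δ X x.1 T (δ s x.2) then g x else 0) =
      k (sw x) + (if IsForest δ X x.1 ∧ ¬ IsForest δ X (sw x).1 ∧ Leads δ X x.1 T s then g x else 0) := by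
    intro x
    simp only [k]
    rw [hsw x, hg]
    by_cases h1 : IsForest δ X x.1
    · by_cases h2 : IsForest δ X (sw x).1
      · simp [h1, h2, leads_iff_of_isForest_update hTX hs h2, sw]
      · simp [h1, h2, leads_iff_of_not_isForest_update hTX hs h1 h2]
    · simp [h1]
  have hperm : ∑ x, k (sw x) = ∑ x, k x := Equiv.sum_comp hsw.toPerm k
  rw [hL, hR, Finset.sum_congr rfl fun x _ => hR' x, Finset.sum_add_distrib, hperm,
    ← Finset.sum_add_distrib]
  refine Finset.sum_congr rfl fun x _ => ?_
  by_cases h1 : IsForest δ X x.1 <;> by_cases h2 : IsForest δ X (sw x).1 <;> simp [k, h1, h2]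

theorem forestProb_nonneg {p : ℝ} (hp : p ∈ Set.Ioo (0 : ℝ) 1) (δ : σ → Bool → σ) (X T : Set σ)
    (u : σ) : 0 ≤ forestProb p δ X T u :=
  Finset.sum_nonneg fun c _ => (configProb_pos hp c).le

theorem sum_wordProb_cons (p : ℝ) (B : Finset (List Bool)) (hB : [] ∉ B) :
    ∑ w ∈ B, wordProb p w = ∑ b, letterProb p b *
      ∑ w ∈ B.preimage (List.cons b) List.cons_injective.injOn, wordProb p w := by
  have h : ∀ b, letterProb p b *
      ∑ w ∈ B.preimage (List.cons b) List.cons_injective.injOn, wordProb p w =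
      ∑ w ∈ B with w ∈ Set.range (List.cons b), wordProb p w := by
    intro b
    rw [← Finset.sum_preimage' (List.cons b) B List.cons_injective.injOn, Finset.mul_sum]
    exact Finset.sum_congr rfl fun w _ => (wordProb_cons p b w).symm
  rw [Fintype.sum_bool, h, h,
    ← Finset.sum_filter_add_sum_filter_not B (· ∈ Set.range (List.cons true))]
  congr 1
  refine Finset.sum_congr (Finset.filter_congr fun w hw => ?_) fun _ _ => rfl
  rcases w with _ | ⟨_ | _, w⟩
  · exact absurd hw hB
  · simp
  · simp

/-- Bound on the probability of finitely many continuations of `v` that end in `T`. -/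
theorem forestProb_univ_mul_sum_le {p : ℝ} (hp : p ∈ Set.Ioo (0 : ℝ) 1) {δ : σ → Bool → σ}
    {start : σ} {T T' : Set σ} (hTT' : T ⊆ T')
    (hpre : PrefixFree {w : List Bool | w.foldl δ start ∈ T'}) (n : ℕ) (v : List Bool)
    (B : Finset (List Bool)) (hn : ∀ w ∈ B, w.length < n)
    (hB : ∀ w ∈ B, (v ++ w).foldl δ start ∈ T) :
    forestProb p δ (absorbing δ T') Set.univ start * ∑ w ∈ B, wordProb p w ≤
      forestProb p δ (absorbing δ T') T (v.foldl δ start) := by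
  have hTX : T ⊆ absorbing δ T' := fun u hu => .inl (hTT' hu)
  induction n generalizing v B with
  | zero =>
    have hB0 : B = ∅ := Finset.eq_empty_of_forall_notMem fun w hw => absurd (hn w hw) (by simp)
    subst hB0
    simpa using forestProb_nonneg hp _ _ _ _
  | succ n ih =>
    rcases B.eq_empty_or_nonempty with rfl | ⟨w₀, hw₀⟩
    · simpa using forestProb_nonneg hp _ _ _ _
    by_cases hv : v.foldl δ start ∈ T'
    · have hnil : ∀ w ∈ B, w = [] := by
        intro w hw
        by_contra hne
        exact hpre v hv (v ++ w) (hTT' (hB w hw)) (by simpa using hne) (List.prefix_append v w)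
      have hB0 : B = {[]} := Finset.eq_singleton_iff_unique_mem.2 ⟨hnil _ hw₀ ▸ hw₀, hnil⟩
      subst hB0
      have hvT : v.foldl δ start ∈ T := by simpa using hB [] (by simp)
      rw [Finset.sum_singleton, wordProb_nil, mul_one]
      refine Finset.sum_le_sum_of_subset_of_nonneg (fun c hc => ?_)
        fun c _ _ => (configProb_pos hp c).le
      simp only [forestsTo, Finset.mem_filter_univ] at hc ⊢
      exact ⟨hc.1, .here hvT⟩
    have hX : v.foldl δ start ∉ absorbing δ T' := by
      rintro (h | h)
      · exact hv h
      · exact h w₀ (by simpa using hTT' (hB _ hw₀))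
    have hnil : [] ∉ B := fun h => hv (hTT' (by simpa using hB _ h))
    rw [forestProb_harmonic p hTX hX, sum_wordProb_cons p B hnil, Finset.mul_sum]
    refine Finset.sum_le_sum fun b _ => ?_
    have h := ih (v ++ [b]) (B.preimage (List.cons b) List.cons_injective.injOn)
      (fun w hw => by simpa using hn _ (Finset.mem_preimage.1 hw))
      (fun w hw => by simpa using hB _ (Finset.mem_preimage.1 hw))
    rw [mul_left_comm]
    refine mul_le_mul_of_nonneg_left ?_ (letterProb_pos hp b).le
    simpa using h

theorem forestProb_univ_pos {p : ℝ} (hp : p ∈ Set.Ioo (0 : ℝ) 1) (δ : σ → Bool → σ)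
    (T : Set σ) (u : σ) : 0 < forestProb p δ (absorbing δ T) Set.univ u := by
  obtain ⟨c, hc⟩ := exists_isForest δ T
  refine Finset.sum_pos (fun c _ => configProb_pos hp c) ⟨c, ?_⟩
  simp only [forestsTo, Finset.mem_filter_univ]
  exact ⟨hc, .here trivial⟩

theorem forestProb_univ_mul_langProb_le {p : ℝ} (hp : p ∈ Set.Ioo (0 : ℝ) 1) {δ : σ → Bool → σ}
    {start : σ} {T T' : Set σ} (hTT' : T ⊆ T')
    (hpre : PrefixFree {w : List Bool | w.foldl δ start ∈ T'}) :
    forestProb p δ (absorbing δ T') Set.univ start *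
        langProb p {w : List Bool | w.foldl δ start ∈ T} ≤
      forestProb p δ (absorbing δ T') T start := by
  have hF := forestProb_univ_pos hp δ T' start
  rw [← le_div_iff₀' hF]
  refine Real.tsum_le_of_sum_le (fun w => (wordProb_pos hp _).le) fun B => ?_
  rw [le_div_iff₀' hF]
  have h := forestProb_univ_mul_sum_le hp hTT' hpre
    ((B.map (Function.Embedding.subtype _)).sup List.length + 1) []
    (B.map (Function.Embedding.subtype _))
    (fun w hw => Nat.lt_succ_of_le (Finset.le_sup (f := List.length) hw))
    (fun w hw => by
      obtain ⟨w, -, rfl⟩ := Finset.mem_map.1 hw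
      exact w.2)
  rwa [Finset.sum_map] at h

/-- The word listing the letters chosen by `c` in all states. -/
noncomputable def configWord (c : σ → Bool) : List Bool :=
  List.ofFn fun i => c ((Fintype.equivFin σ).symm i)

theorem configWord_injective : Function.Injective (configWord (σ := σ)) := by
  intro c c' h
  funext u
  simpa using congrFun (List.ofFn_injective h) (Fintype.equivFin σ u)

theorem wordProb_configWord (p : ℝ) (c : σ → Bool) :
    wordProb p (configWord c) = configProb p c := by
  rw [wordProb_eq_prod, configWord, List.map_ofFn, List.prod_ofFn]
  exact Equiv.prod_comp (Fintype.equivFin σ).symm fun u => letterProb p (c u)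

theorem finsetProb_image_configWord (p : ℝ) (S : Finset (σ → Bool)) :
    finsetProb p (S.image configWord) = ∑ c ∈ S, configProb p c := by
  rw [finsetProb, Finset.sum_image configWord_injective.injOn]
  exact Finset.sum_congr rfl fun c _ => wordProb_configWord p c

theorem disjoint_forestsTo (δ : σ → Bool → σ) {X T T' : Set σ} (hTX : T ⊆ X) (hTX' : T' ⊆ X)
    (hd : Disjoint T T') (u : σ) : Disjoint (forestsTo δ X T u) (forestsTo δ X T' u) := by
  refine Finset.disjoint_left.2 fun c hc hc' => ?_
  simp only [forestsTo, Finset.mem_filter_univ] at hc hc'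
  exact hc.2.disjoint hTX hTX' hd hc'.2

theorem forestProb_add_le {p : ℝ} (hp : p ∈ Set.Ioo (0 : ℝ) 1) (δ : σ → Bool → σ)
    {X T T' : Set σ} (hTX : T ⊆ X) (hTX' : T' ⊆ X) (hd : Disjoint T T') (u : σ) :
    forestProb p δ X T u + forestProb p δ X T' u ≤ forestProb p δ X Set.univ u := by
  unfold forestProb
  rw [← Finset.sum_union (disjoint_forestsTo δ hTX hTX' hd u)]
  refine Finset.sum_le_sum_of_subset_of_nonneg (fun c hc => ?_)
    fun c _ _ => (configProb_pos hp c).le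
  simp only [forestsTo, Finset.mem_union, Finset.mem_filter_univ] at hc ⊢
  exact ⟨hc.elim And.left And.left, .here trivial⟩

/-- The Markov chain tree theorem for the absorption probabilities of an automaton that is driven
by coin tosses and stops almost surely. -/
theorem forestProb_eq_mul_langProb {p : ℝ} (hp : p ∈ Set.Ioo (0 : ℝ) 1) {δ : σ → Bool → σ}
    {start : σ} {T₀ T₁ : Set σ} (hd : Disjoint T₀ T₁)
    (hpre : PrefixFree {w : List Bool | w.foldl δ start ∈ T₀ ∪ T₁})
    (htotal : langProb p {w : List Bool | w.foldl δ start ∈ T₀ ∪ T₁} = 1) :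
    forestProb p δ (absorbing δ (T₀ ∪ T₁)) T₁ start =
        forestProb p δ (absorbing δ (T₀ ∪ T₁)) Set.univ start *
          langProb p {w : List Bool | w.foldl δ start ∈ T₁} ∧
      forestProb p δ (absorbing δ (T₀ ∪ T₁)) T₀ start +
          forestProb p δ (absorbing δ (T₀ ∪ T₁)) T₁ start =
        forestProb p δ (absorbing δ (T₀ ∪ T₁)) Set.univ start := by
  have h₀ := forestProb_univ_mul_langProb_le hp Set.subset_union_left hpre
  have h₁ := forestProb_univ_mul_langProb_le hp Set.subset_union_right hpre
  have hle := forestProb_add_le hp δ (X := absorbing δ (T₀ ∪ T₁)) (fun u hu => .inl (.inl hu))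
    (fun u hu => .inl (.inr hu)) hd start
  have hsum : langProb p {w : List Bool | w.foldl δ start ∈ T₀} +
      langProb p {w : List Bool | w.foldl δ start ∈ T₁} = 1 := by
    rw [← htotal]
    refine (tsum_union_disjoint_of_ne_zero ?_ ?_).symm
    · exact hd.preimage fun w : List Bool => w.foldl δ start
    · exact htotal.trans_ne one_ne_zero
  have hmul := congrArg (forestProb p δ (absorbing δ (T₀ ∪ T₁)) Set.univ start * ·) hsum
  simp only [mul_add, mul_one] at hmul
  constructor <;> linarith

end

theorem stmt_3 (D : Set ℝ) (hD : D ⊆ Set.Ioo (0:ℝ) 1) (f : ℝ → ℝ)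
    (hf : ∀ p ∈ D, f p ∈ Set.Ioo (0:ℝ) 1)
    (L₀ L₁ : Set (List Bool))
    (hreg₀ : Language.IsRegular (L₀ : Language Bool))
    (hreg₁ : Language.IsRegular (L₁ : Language Bool))
    (hdisj : Disjoint L₀ L₁)
    (hpre : PrefixFree (L₀ ∪ L₁))
    (htotal : ∀ p ∈ D, langProb p (L₀ ∪ L₁) = 1)
    (hsim : ∀ p ∈ D, langProb p L₁ = f p) :
    ∃ (k : ℕ) (A₀ A₁ : Finset (List Bool)), 1 ≤ k ∧
      (∀ w ∈ A₀ ∪ A₁, w.length = k) ∧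
      Disjoint A₀ A₁ ∧ (A₀ ∪ A₁).Nonempty ∧
      ∀ p ∈ D,
        0 < finsetProb p (A₀ ∪ A₁) ∧
        f p = finsetProb p A₁ / finsetProb p (A₀ ∪ A₁) := by
  rcases D.eq_empty_or_nonempty with rfl | ⟨p₀, hp₀⟩
  · exact ⟨1, {[true]}, ∅, le_rfl, by simp⟩
  obtain ⟨σ₀, _, M₀, hM₀⟩ := hreg₀
  obtain ⟨σ₁, _, M₁, hM₁⟩ := hreg₁
  have hmem₀ : ∀ w, w.foldl M₀.step M₀.start ∈ M₀.accept ↔ w ∈ L₀ :=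
    fun w => Iff.of_eq (congrArg (w ∈ ·) hM₀)
  have hmem₁ : ∀ w, w.foldl M₁.step M₁.start ∈ M₁.accept ↔ w ∈ L₁ :=
    fun w => Iff.of_eq (congrArg (w ∈ ·) hM₁)
  let δ : σ₀ × σ₁ → Bool → σ₀ × σ₁ := fun u b => (M₀.step u.1 b, M₁.step u.2 b)
  let start : σ₀ × σ₁ := (M₀.start, M₁.start)
  let T₁ : Set (σ₀ × σ₁) := {u | u.2 ∈ M₁.accept}
  let T₀ : Set (σ₀ × σ₁) := {u | u.1 ∈ M₀.accept} \ T₁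
  have hδ : ∀ (w : List Bool) (u : σ₀ × σ₁),
      w.foldl δ u = (w.foldl M₀.step u.1, w.foldl M₁.step u.2) := by
    intro w
    induction w with
    | nil => exact fun u => rfl
    | cons b w ih => exact fun u => ih _
  have hL₁ : {w : List Bool | w.foldl δ start ∈ T₁} = L₁ := by
    ext w
    rw [Set.mem_ofPred_eq, hδ]
    exact hmem₁ w
  have hL : {w : List Bool | w.foldl δ start ∈ T₀ ∪ T₁} = L₀ ∪ L₁ := by
    ext w
    rw [Set.mem_ofPred_eq, hδ, Set.sdiff_union_self]
    exact or_congr (hmem₀ w) (hmem₁ w)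
  have hd : Disjoint T₀ T₁ := Set.disjoint_sdiff_left
  have hdA := disjoint_forestsTo δ (X := absorbing δ (T₀ ∪ T₁)) (fun u hu => .inl (.inl hu))
    (fun u hu => .inl (.inr hu)) hd start
  rw [← hL] at hpre
  set A₀ := forestsTo δ (absorbing δ (T₀ ∪ T₁)) T₀ start
  set A₁ := forestsTo δ (absorbing δ (T₀ ∪ T₁)) T₁ start
  have key : ∀ p ∈ D, 0 < finsetProb p (A₀.image configWord ∪ A₁.image configWord) ∧
      f p = finsetProb p (A₁.image configWord) /
        finsetProb p (A₀.image configWord ∪ A₁.image configWord) := by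
    intro p hp
    obtain ⟨h₁, h⟩ := forestProb_eq_mul_langProb (hD hp) hd hpre (by rw [hL, htotal p hp])
    have hpos := forestProb_univ_pos (hD hp) δ (T₀ ∪ T₁) start
    have hunion : finsetProb p (A₀.image configWord ∪ A₁.image configWord) =
        forestProb p δ (absorbing δ (T₀ ∪ T₁)) Set.univ start := by
      rw [← Finset.image_union, finsetProb_image_configWord, Finset.sum_union hdA, ← h]
      rfl
    rw [hL₁, hsim p hp] at h₁
    rw [hunion, finsetProb_image_configWord]
    exact ⟨hpos, ((div_eq_iff hpos.ne').2 (h₁.trans (mul_comm _ _))).symm⟩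
  refine ⟨Fintype.card (σ₀ × σ₁), A₀.image configWord, A₁.image configWord,
    Fintype.card_pos_iff.2 ⟨start⟩, ?_, ?_, ?_, key⟩
  · intro w hw
    rw [← Finset.image_union] at hw
    obtain ⟨c, -, rfl⟩ := Finset.mem_image.1 hw
    exact List.length_ofFn
  · exact (Finset.disjoint_image configWord_injective).2 hdA
  · exact Finset.nonempty_of_sum_ne_zero (key p₀ hp₀).1.ne'
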